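/- arXiv:0711.2568 — 3 statements merged into one kernel-verified Lean document; each statement's English description precedes it below -/
import Mathlib

section
/- Under the motion law ∂_t x = β N + α T, the curvature satisfies the evolution equation ∂_t k = ∂_s² β + α ∂_s k + k² β, where ∂_s = g⁻¹ ∂_u and ∂_s² β = g⁻¹ ∂_u (g⁻¹ ∂_u β). -/
noncomputable section

open Real Filter

/-- Time domain `[0, Tmax)`; the final time `Tmax ∈ (0, ∞]` is encoded as an `EReal`. -/
def timeDom (Tmax : EReal) : Set ℝ := {t : ℝ | 0 ≤ t ∧ (t : EReal) < Tmax}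

/-- The filter of times `t` approaching `Tmax` from below (equals `atTop` if `Tmax = ∞`). -/
def toTime (Tmax : EReal) : Filter ℝ :=
  Filter.comap (fun t : ℝ => (t : EReal)) (nhdsWithin Tmax (Set.Iio Tmax))

/-- Euclidean length of a plane vector. -/
def elen (v : ℝ × ℝ) : ℝ := Real.sqrt (v.1 ^ 2 + v.2 ^ 2)

/-- Rotation of a plane vector by `π/2`, taking the unit tangent to the unit inward
normal, so that `det (v, rot v) = |v|² ≥ 0`. -/
def rot (v : ℝ × ℝ) : ℝ × ℝ := (-v.2, v.1)

/-- Local length `g(u,t) = |∂_u x(u,t)|`. -/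
def gl (x : ℝ → ℝ → ℝ × ℝ) (u t : ℝ) : ℝ := elen (deriv (fun u' => x u' t) u)

/-- Unit tangent vector `T = ∂_s x = g⁻¹ ∂_u x`. -/
def tang (x : ℝ → ℝ → ℝ × ℝ) (u t : ℝ) : ℝ × ℝ :=
  (gl x u t)⁻¹ • deriv (fun u' => x u' t) u

/-- Unit inward normal vector `N = rot T`. -/
def nor (x : ℝ → ℝ → ℝ × ℝ) (u t : ℝ) : ℝ × ℝ := rot (tang x u t)

/-- Total length `L(t) = ∫₀¹ g(u,t) du`. -/
def len (x : ℝ → ℝ → ℝ × ℝ) (t : ℝ) : ℝ := ∫ u in (0:ℝ)..1, gl x u t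

/-- Arc-length average `⟨F⟩(t) = L(t)⁻¹ ∫₀¹ F g du`. -/
def avg (x : ℝ → ℝ → ℝ × ℝ) (F : ℝ → ℝ → ℝ) (t : ℝ) : ℝ :=
  (len x t)⁻¹ * ∫ u in (0:ℝ)..1, F u t * gl x u t

/-- Arc-length derivative `∂_s F = g⁻¹ ∂_u F` of a scalar quantity. -/
def sder (x : ℝ → ℝ → ℝ × ℝ) (F : ℝ → ℝ → ℝ) (u t : ℝ) : ℝ :=
  (gl x u t)⁻¹ * deriv (fun u' => F u' t) u

open Set Topology

section PartialDerivatives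

variable {E : Type*} [NormedAddCommGroup E] [NormedSpace ℝ E]

/-- Partial derivative in the first variable. -/
def pderivFst (F : ℝ → ℝ → E) (u t : ℝ) : E := deriv (fun v => F v t) u

/-- Partial derivative in the second variable. -/
def pderivSnd (F : ℝ → ℝ → E) (u t : ℝ) : E := deriv (fun r => F u r) t

variable {F : ℝ → ℝ → E}

lemma hasDerivAt_fst_fderiv (hF : ContDiff ℝ (⊤ : ℕ∞) (Function.uncurry F)) (u t : ℝ) :
    HasDerivAt (fun u' => F u' t) (fderiv ℝ (Function.uncurry F) (u, t) (1, 0)) u :=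
  HasFDerivAt.comp_hasDerivAt (f := fun u' => (u', t)) u
    ((hF.differentiable (by simp)) (u, t)).hasFDerivAt
    ((hasDerivAt_id u).prodMk (hasDerivAt_const u t))

lemma hasDerivAt_snd_fderiv (hF : ContDiff ℝ (⊤ : ℕ∞) (Function.uncurry F)) (u t : ℝ) :
    HasDerivAt (fun t' => F u t') (fderiv ℝ (Function.uncurry F) (u, t) (0, 1)) t :=
  HasFDerivAt.comp_hasDerivAt (f := fun t' => (u, t')) t
    ((hF.differentiable (by simp)) (u, t)).hasFDerivAt
    ((hasDerivAt_const t u).prodMk (hasDerivAt_id t))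

lemma hasDerivAt_pderivFst (hF : ContDiff ℝ (⊤ : ℕ∞) (Function.uncurry F)) (u t : ℝ) :
    HasDerivAt (fun u' => F u' t) (pderivFst F u t) u :=
  (hasDerivAt_fst_fderiv hF u t).differentiableAt.hasDerivAt

lemma hasDerivAt_pderivSnd (hF : ContDiff ℝ (⊤ : ℕ∞) (Function.uncurry F)) (u t : ℝ) :
    HasDerivAt (fun t' => F u t') (pderivSnd F u t) t :=
  (hasDerivAt_snd_fderiv hF u t).differentiableAt.hasDerivAt

lemma uncurry_pderivFst (hF : ContDiff ℝ (⊤ : ℕ∞) (Function.uncurry F)) :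
    Function.uncurry (pderivFst F) = fun p => fderiv ℝ (Function.uncurry F) p (1, 0) :=
  funext fun p => (hasDerivAt_fst_fderiv hF p.1 p.2).deriv

lemma uncurry_pderivSnd (hF : ContDiff ℝ (⊤ : ℕ∞) (Function.uncurry F)) :
    Function.uncurry (pderivSnd F) = fun p => fderiv ℝ (Function.uncurry F) p (0, 1) :=
  funext fun p => (hasDerivAt_snd_fderiv hF p.1 p.2).deriv

lemma contDiff_fderiv_top {f : ℝ × ℝ → E} (hf : ContDiff ℝ (⊤ : ℕ∞) f) :
    ContDiff ℝ (⊤ : ℕ∞) (fderiv ℝ f) :=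
  hf.fderiv_right (by simp)

lemma contDiff_pderivFst (hF : ContDiff ℝ (⊤ : ℕ∞) (Function.uncurry F)) :
    ContDiff ℝ (⊤ : ℕ∞) (Function.uncurry (pderivFst F)) := by
  rw [uncurry_pderivFst hF]
  exact (contDiff_fderiv_top hF).clm_apply contDiff_const

lemma contDiff_pderivSnd (hF : ContDiff ℝ (⊤ : ℕ∞) (Function.uncurry F)) :
    ContDiff ℝ (⊤ : ℕ∞) (Function.uncurry (pderivSnd F)) := by
  rw [uncurry_pderivSnd hF]
  exact (contDiff_fderiv_top hF).clm_apply contDiff_const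

/-- Mixed partial derivatives of a smooth function commute. -/
lemma pderivSnd_pderivFst (hF : ContDiff ℝ (⊤ : ℕ∞) (Function.uncurry F)) :
    pderivSnd (pderivFst F) = pderivFst (pderivSnd F) := by
  funext u t
  have hd : HasFDerivAt (fderiv ℝ (Function.uncurry F))
      (fderiv ℝ (fderiv ℝ (Function.uncurry F)) (u, t)) (u, t) :=
    ((contDiff_fderiv_top hF).differentiable (by simp) (u, t)).hasFDerivAt
  have hsymm : IsSymmSndFDerivAt ℝ (Function.uncurry F) (u, t) :=
    hF.contDiffAt.isSymmSndFDerivAt (by simpa using WithTop.coe_le_coe.2 (le_top : (2 : ℕ∞) ≤ ⊤))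
  have h1 := hasDerivAt_snd_fderiv (contDiff_pderivFst hF) u t
  have h2 := hasDerivAt_fst_fderiv (contDiff_pderivSnd hF) u t
  rw [uncurry_pderivFst hF, (hd.clm_apply (hasFDerivAt_const _ _)).fderiv] at h1
  rw [uncurry_pderivSnd hF, (hd.clm_apply (hasFDerivAt_const _ _)).fderiv] at h2
  refine h1.deriv.trans (Eq.trans ?_ h2.deriv.symm)
  simpa using hsymm (0, 1) (1, 0)

end PartialDerivatives

/-- Functions agreeing on `timeDom Tmax` have equal derivatives there, the left endpoint
included. -/
lemma hasDerivAt_unique_of_eqOn_timeDom {Tmax : EReal} {f h : ℝ → ℝ} {f' h' t : ℝ}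
    (ht : t ∈ timeDom Tmax) (hfh : EqOn f h (timeDom Tmax))
    (hf : HasDerivAt f f' t) (hh : HasDerivAt h h' t) : f' = h' := by
  obtain ⟨s, hts, hs⟩ := EReal.lt_iff_exists_real_btwn.1 ht.2
  have hev : h =ᶠ[𝓝[≥] t] f := by
    filter_upwards [Ico_mem_nhdsGE (EReal.coe_lt_coe_iff.1 hts)] with r hr
    exact (hfh ⟨ht.1.trans hr.1, (EReal.coe_lt_coe_iff.2 hr.2).trans hs⟩).symm
  exact (uniqueDiffWithinAt_Ici t).eq_deriv _ (hf.hasDerivWithinAt.congr_of_eventuallyEq hev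
    (hfh ht).symm) hh.hasDerivWithinAt

/-- Under the motion law `∂_t x = β N + α T`, the curvature satisfies
`∂_t k = ∂_s² β + α ∂_s k + k² β`, where `∂_s = g⁻¹ ∂_u` and `∂_s² β = g⁻¹ ∂_u (g⁻¹ ∂_u β)`. -/
theorem curvature_evolution
    (Tmax : EReal) (hTmax : 0 < Tmax)
    (x : ℝ → ℝ → ℝ × ℝ) (β α k : ℝ → ℝ → ℝ)
    (hx : ContDiff ℝ (⊤ : ℕ∞) (Function.uncurry x))
    (hβ : ContDiff ℝ (⊤ : ℕ∞) (Function.uncurry β))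
    (hα : ContDiff ℝ (⊤ : ℕ∞) (Function.uncurry α))
    (hk : ContDiff ℝ (⊤ : ℕ∞) (Function.uncurry k))
    (hxper : ∀ t : ℝ, Function.Periodic (fun u => x u t) 1)
    (hg : ∀ (u t : ℝ), t ∈ timeDom Tmax → 0 < gl x u t)
    (hfrenet : ∀ (u t : ℝ), t ∈ timeDom Tmax →
      deriv (fun u' => tang x u' t) u = (gl x u t * k u t) • nor x u t)
    (hmotion : ∀ (u t : ℝ), t ∈ timeDom Tmax →
      deriv (fun t' => x u t') t = β u t • nor x u t + α u t • tang x u t)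
    :
    ∀ (u t : ℝ), t ∈ timeDom Tmax →
      deriv (fun t' => k u t') t
        = sder x (sder x β) u t + α u t * sder x k u t + (k u t) ^ 2 * β u t := by
  intro u t ht
  set X : ℝ → ℝ → ℝ := fun u t => (x u t).1
  set Y : ℝ → ℝ → ℝ := fun u t => (x u t).2
  have hX : ContDiff ℝ (⊤ : ℕ∞) (Function.uncurry X) := contDiff_fst.comp hx
  have hY : ContDiff ℝ (⊤ : ℕ∞) (Function.uncurry Y) := contDiff_snd.comp hx
  have hX1 := contDiff_pderivFst hX
  have hY1 := contDiff_pderivFst hY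
  have hX2 := contDiff_pderivFst hX1
  have hY2 := contDiff_pderivFst hY1
  have hβ1 := contDiff_pderivFst hβ
  have hα1 := contDiff_pderivFst hα
  have hxu (v r : ℝ) : deriv (fun u' => x u' r) v = (pderivFst X v r, pderivFst Y v r) :=
    ((hasDerivAt_pderivFst hX v r).prodMk (hasDerivAt_pderivFst hY v r)).deriv
  have hxt (v r : ℝ) : deriv (fun t' => x v t') r = (pderivSnd X v r, pderivSnd Y v r) :=
    ((hasDerivAt_pderivSnd hX v r).prodMk (hasDerivAt_pderivSnd hY v r)).deriv
  have hgl (v r : ℝ) : gl x v r = √(pderivFst X v r ^ 2 + pderivFst Y v r ^ 2) := by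
    rw [gl, hxu, elen]
  have hsq (v r : ℝ) : gl x v r ^ 2 = pderivFst X v r ^ 2 + pderivFst Y v r ^ 2 := by
    rw [hgl, Real.sq_sqrt (by positivity)]
  have hne (v r : ℝ) (hr : r ∈ timeDom Tmax) :
      pderivFst X v r ^ 2 + pderivFst Y v r ^ 2 ≠ 0 := by
    rw [← hsq]; exact (pow_pos (hg v r hr) 2).ne'
  have hgu (v r : ℝ) (hr : r ∈ timeDom Tmax) :
      HasDerivAt (fun u' => gl x u' r) (pderivFst (gl x) v r) v := by
    refine DifferentiableAt.hasDerivAt ?_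
    simp only [hgl]
    exact (((hasDerivAt_pderivFst hX1 v r).differentiableAt.pow 2).add
      ((hasDerivAt_pderivFst hY1 v r).differentiableAt.pow 2)).sqrt (hne v r hr)
  have hgt (v r : ℝ) (hr : r ∈ timeDom Tmax) :
      HasDerivAt (fun t' => gl x v t') (pderivSnd (gl x) v r) r := by
    refine DifferentiableAt.hasDerivAt ?_
    simp only [hgl]
    exact (((hasDerivAt_pderivSnd hX1 v r).differentiableAt.pow 2).add
      ((hasDerivAt_pderivSnd hY1 v r).differentiableAt.pow 2)).sqrt (hne v r hr)
  -- `(a, b)` are the components of the unit tangent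
  set a : ℝ → ℝ → ℝ := fun u t => (tang x u t).1 with ha
  set b : ℝ → ℝ → ℝ := fun u t => (tang x u t).2 with hb
  have ha' (v r : ℝ) : a v r = (gl x v r)⁻¹ * pderivFst X v r := by
    simp [ha, tang, hxu]
  have hb' (v r : ℝ) : b v r = (gl x v r)⁻¹ * pderivFst Y v r := by
    simp [hb, tang, hxu]
  have hXga (v r : ℝ) (hr : r ∈ timeDom Tmax) : pderivFst X v r = gl x v r * a v r := by
    rw [ha', mul_inv_cancel_left₀ (hg v r hr).ne']
  have hYgb (v r : ℝ) (hr : r ∈ timeDom Tmax) : pderivFst Y v r = gl x v r * b v r := by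
    rw [hb', mul_inv_cancel_left₀ (hg v r hr).ne']
  have hunit (v r : ℝ) (hr : r ∈ timeDom Tmax) : a v r ^ 2 + b v r ^ 2 = 1 := by
    have h := hsq v r
    rw [hXga v r hr, hYgb v r hr] at h
    have h0 : gl x v r ^ 2 ≠ 0 := (pow_pos (hg v r hr) 2).ne'
    apply mul_left_cancel₀ h0
    linear_combination -h
  have htang (v r : ℝ) (hr : r ∈ timeDom Tmax) :
      HasDerivAt (fun u' => a u' r) (-(gl x v r * k v r * b v r)) v ∧
      HasDerivAt (fun u' => b u' r) (gl x v r * k v r * a v r) v := by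
    have hda : DifferentiableAt ℝ (fun u' => a u' r) v := by
      simp only [ha']
      exact ((hgu v r hr).differentiableAt.inv (hg v r hr).ne').mul
        (hasDerivAt_pderivFst hX1 v r).differentiableAt
    have hdb : DifferentiableAt ℝ (fun u' => b u' r) v := by
      simp only [hb']
      exact ((hgu v r hr).differentiableAt.inv (hg v r hr).ne').mul
        (hasDerivAt_pderivFst hY1 v r).differentiableAt
    have h := (hda.hasDerivAt.prodMk hdb.hasDerivAt).deriv.symm.trans (hfrenet v r hr)
    simp only [nor, rot, Prod.smul_mk, smul_eq_mul, Prod.mk.injEq] at h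
    constructor
    · simpa [h.1] using hda.hasDerivAt
    · simpa [h.2] using hdb.hasDerivAt
  have hXt (v r : ℝ) (hr : r ∈ timeDom Tmax) :
      pderivSnd X v r = α v r * a v r - β v r * b v r := by
    have h := congrArg Prod.fst ((hxt v r).symm.trans (hmotion v r hr))
    simp only [nor, rot, Prod.fst_add, Prod.smul_fst, smul_eq_mul] at h
    rw [h]; simp only [ha, hb]; ring
  have hYt (v r : ℝ) (hr : r ∈ timeDom Tmax) :
      pderivSnd Y v r = α v r * b v r + β v r * a v r := by
    have h := congrArg Prod.snd ((hxt v r).symm.trans (hmotion v r hr))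
    simp only [nor, rot, Prod.snd_add, Prod.smul_snd, smul_eq_mul] at h
    rw [h]; simp only [ha, hb]; ring
  -- tangential and normal components of `∂_t ∂_u x`
  set P : ℝ → ℝ → ℝ := fun u t => pderivFst α u t - β u t * (gl x u t * k u t) with hP
  set Q : ℝ → ℝ → ℝ := fun u t => pderivFst β u t + α u t * (gl x u t * k u t) with hQ
  have hXut (v r : ℝ) (hr : r ∈ timeDom Tmax) :
      pderivSnd (pderivFst X) v r = P v r * a v r - Q v r * b v r := by
    rw [pderivSnd_pderivFst hX]
    have h := ((hasDerivAt_pderivFst hα v r).mul (htang v r hr).1).sub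
      ((hasDerivAt_pderivFst hβ v r).mul (htang v r hr).2)
    have he : (fun u' => pderivSnd X u' r) = fun u' => α u' r * a u' r - β u' r * b u' r :=
      funext fun v => hXt v r hr
    rw [pderivFst, he]
    refine h.deriv.trans ?_
    simp only [hP, hQ]; ring
  have hYut (v r : ℝ) (hr : r ∈ timeDom Tmax) :
      pderivSnd (pderivFst Y) v r = P v r * b v r + Q v r * a v r := by
    rw [pderivSnd_pderivFst hY]
    have h := ((hasDerivAt_pderivFst hα v r).mul (htang v r hr).2).add
      ((hasDerivAt_pderivFst hβ v r).mul (htang v r hr).1)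
    have he : (fun u' => pderivSnd Y u' r) = fun u' => α u' r * b u' r + β u' r * a u' r :=
      funext fun v => hYt v r hr
    rw [pderivFst, he]
    refine h.deriv.trans ?_
    simp only [hP, hQ]; ring
  have hgk := (hgu u t ht).mul (hasDerivAt_pderivFst hk u t)
  have hPu : HasDerivAt (fun u' => P u' t) (pderivFst P u t) u :=
    ((hasDerivAt_pderivFst hα1 u t).sub
      ((hasDerivAt_pderivFst hβ u t).mul hgk)).differentiableAt.hasDerivAt
  have hQu : HasDerivAt (fun u' => Q u' t) (pderivFst (pderivFst β) u t
      + (pderivFst α u t * (gl x u t * k u t)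
        + α u t * (pderivFst (gl x) u t * k u t + gl x u t * pderivFst k u t))) u :=
    (hasDerivAt_pderivFst hβ1 u t).add ((hasDerivAt_pderivFst hα u t).mul hgk)
  have hXuut : pderivSnd (pderivFst (pderivFst X)) u t =
      pderivFst P u t * a u t + P u t * -(gl x u t * k u t * b u t)
        - (deriv (fun u' => Q u' t) u * b u t + Q u t * (gl x u t * k u t * a u t)) := by
    rw [pderivSnd_pderivFst hX1, pderivFst,
      show (fun u' => pderivSnd (pderivFst X) u' t) = fun u' => P u' t * a u' t - Q u' t * b u' t
        from funext fun v => hXut v t ht, hQu.deriv]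
    exact ((hPu.mul (htang u t ht).1).sub (hQu.mul (htang u t ht).2)).deriv
  have hYuut : pderivSnd (pderivFst (pderivFst Y)) u t =
      pderivFst P u t * b u t + P u t * (gl x u t * k u t * a u t)
        + (deriv (fun u' => Q u' t) u * a u t + Q u t * -(gl x u t * k u t * b u t)) := by
    rw [pderivSnd_pderivFst hY1, pderivFst,
      show (fun u' => pderivSnd (pderivFst Y) u' t) = fun u' => P u' t * b u' t + Q u' t * a u' t
        from funext fun v => hYut v t ht, hQu.deriv]
    exact ((hPu.mul (htang u t ht).2).add (hQu.mul (htang u t ht).1)).deriv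
  have hXuu (v r : ℝ) (hr : r ∈ timeDom Tmax) : pderivFst (pderivFst X) v r =
      pderivFst (gl x) v r * a v r - gl x v r ^ 2 * k v r * b v r := by
    rw [pderivFst, show (fun u' => pderivFst X u' r) = fun u' => gl x u' r * a u' r
      from funext fun v => hXga v r hr]
    refine ((hgu v r hr).mul (htang v r hr).1).deriv.trans ?_
    ring
  have hYuu (v r : ℝ) (hr : r ∈ timeDom Tmax) : pderivFst (pderivFst Y) v r =
      pderivFst (gl x) v r * b v r + gl x v r ^ 2 * k v r * a v r := by
    rw [pderivFst, show (fun u' => pderivFst Y u' r) = fun u' => gl x u' r * b u' r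
      from funext fun v => hYgb v r hr]
    refine ((hgu v r hr).mul (htang v r hr).2).deriv.trans ?_
    ring
  have hgP : pderivSnd (gl x) u t = P u t := by
    have h1 := (hgt u t ht).pow 2
    have h2 := ((hasDerivAt_pderivSnd hX1 u t).pow 2).add ((hasDerivAt_pderivSnd hY1 u t).pow 2)
    have h := hasDerivAt_unique_of_eqOn_timeDom ht (fun r _ => hsq u r) h1 h2
    rw [hXut u t ht, hYut u t ht, hXga u t ht, hYgb u t ht] at h
    apply mul_left_cancel₀ (hg u t ht).ne'
    norm_num at h
    linear_combination h / 2 + gl x u t * P u t * hunit u t ht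
  have hcurv : EqOn (fun r => k u r * gl x u r ^ 3)
      (fun r => pderivFst X u r * pderivFst (pderivFst Y) u r
        - pderivFst Y u r * pderivFst (pderivFst X) u r) (timeDom Tmax) := by
    intro r hr
    simp only [hXuu u r hr, hYuu u r hr, hXga u r hr, hYgb u r hr]
    linear_combination -(k u r * gl x u r ^ 3) * hunit u r hr
  have hmain := hasDerivAt_unique_of_eqOn_timeDom ht hcurv
    ((hasDerivAt_pderivSnd hk u t).mul ((hgt u t ht).pow 3))
    (((hasDerivAt_pderivSnd hX1 u t).mul (hasDerivAt_pderivSnd hY2 u t)).sub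
      ((hasDerivAt_pderivSnd hY1 u t).mul (hasDerivAt_pderivSnd hX2 u t)))
  have hss : sder x (sder x β) u t = (gl x u t)⁻¹ *
      (-pderivFst (gl x) u t / gl x u t ^ 2 * pderivFst β u t
        + (gl x u t)⁻¹ * pderivFst (pderivFst β) u t) :=
    congrArg ((gl x u t)⁻¹ * ·)
      (((hgu u t ht).inv (hg u t ht).ne').mul (hasDerivAt_pderivFst hβ1 u t)).deriv
  have hs : sder x k u t = (gl x u t)⁻¹ * pderivFst k u t := rfl
  change pderivSnd k u t = _
  have hg0 := (hg u t ht).ne'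
  rw [hss, hs]
  rw [hgP, hXuut, hYuut, hQu.deriv, hXut u t ht, hYut u t ht, hXuu u t ht, hYuu u t ht, hXga u t ht,
    hYgb u t ht] at hmain
  generalize pderivFst P u t = Pu at hmain
  norm_num [hP, hQ] at hmain
  have key : pderivSnd k u t * gl x u t ^ 3 = gl x u t * pderivFst (pderivFst β) u t
      - pderivFst β u t * pderivFst (gl x) u t + α u t * gl x u t ^ 2 * pderivFst k u t
      + β u t * gl x u t ^ 3 * k u t ^ 2 := by
    linear_combination hmain + (gl x u t * pderivFst (pderivFst β) u t
      - pderivFst β u t * pderivFst (gl x) u t + α u t * gl x u t ^ 2 * pderivFst k u t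
      + β u t * gl x u t ^ 3 * k u t ^ 2 + 3 * k u t * gl x u t ^ 2 *
        (pderivFst α u t - β u t * (gl x u t * k u t))) * hunit u t ht
  field_simp
  linear_combination key
end
end

section
/- Under the motion law ∂_t x = β N + α T, the quantity ln(g φ(k)) satisfies ∂_t ln(g φ(k)) = −f/φ(k) + ∂_s(φ(k)α)/φ(k), where f = φ(k) k β − (∂_s²β + k²β) φ'(k) and φ > 0 is smooth. -/
noncomputable section

open Real Filter

/-- The quantity `f = φ(k) k β − (∂_s²β + k²β) φ'(k)` from the redistribution equation. -/
def fphi (x : ℝ → ℝ → ℝ × ℝ) (φ : ℝ → ℝ) (k β : ℝ → ℝ → ℝ) (u t : ℝ) : ℝ :=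
  φ (k u t) * k u t * β u t
    - (sder x (sder x β) u t + (k u t) ^ 2 * β u t) * deriv φ (k u t)

/-- Extended relative local length `r_φ = g φ(k) / (L ⟨φ(k)⟩)`. -/
def rphi (x : ℝ → ℝ → ℝ × ℝ) (φ : ℝ → ℝ) (k : ℝ → ℝ → ℝ) (u t : ℝ) : ℝ :=
  gl x u t * φ (k u t) / (len x t * avg x (fun u' t' => φ (k u' t')) t)

/-- Partial derivative in the first variable of a function on the plane. -/
def partialFst (F : ℝ × ℝ → ℝ) (p : ℝ × ℝ) : ℝ := fderiv ℝ F p (1, 0)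

/-- Partial derivative in the second variable of a function on the plane. -/
def partialSnd (F : ℝ × ℝ → ℝ) (p : ℝ × ℝ) : ℝ := fderiv ℝ F p (0, 1)

theorem DifferentiableAt.hasDerivAt_partialFst {F : ℝ × ℝ → ℝ} {u t : ℝ}
    (hF : DifferentiableAt ℝ F (u, t)) :
    HasDerivAt (fun u' => F (u', t)) (partialFst F (u, t)) u :=
  hF.hasFDerivAt.comp_hasDerivAt u ((hasDerivAt_id u).prodMk (hasDerivAt_const u t))

theorem DifferentiableAt.hasDerivAt_partialSnd {F : ℝ × ℝ → ℝ} {u t : ℝ}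
    (hF : DifferentiableAt ℝ F (u, t)) :
    HasDerivAt (fun t' => F (u, t')) (partialSnd F (u, t)) t :=
  hF.hasFDerivAt.comp_hasDerivAt t ((hasDerivAt_const t u).prodMk (hasDerivAt_id t))

theorem ContDiffAt.partialFst {F : ℝ × ℝ → ℝ} {p : ℝ × ℝ}
    (hF : ContDiffAt ℝ (⊤ : ℕ∞) F p) : ContDiffAt ℝ (⊤ : ℕ∞) (partialFst F) p :=
  (hF.fderiv_right (m := (⊤ : ℕ∞)) (by simp)).clm_apply contDiffAt_const

theorem ContDiffAt.partialSnd {F : ℝ × ℝ → ℝ} {p : ℝ × ℝ}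
    (hF : ContDiffAt ℝ (⊤ : ℕ∞) F p) : ContDiffAt ℝ (⊤ : ℕ∞) (partialSnd F) p :=
  (hF.fderiv_right (m := (⊤ : ℕ∞)) (by simp)).clm_apply contDiffAt_const

theorem ContDiffAt.differentiableAt_of_top {F : ℝ × ℝ → ℝ} {p : ℝ × ℝ}
    (hF : ContDiffAt ℝ (⊤ : ℕ∞) F p) : DifferentiableAt ℝ F p :=
  hF.differentiableAt (by simp)

theorem ContDiffAt.partialSnd_partialFst {F : ℝ × ℝ → ℝ} {p : ℝ × ℝ}
    (hF : ContDiffAt ℝ (⊤ : ℕ∞) F p) :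
    _root_.partialSnd (_root_.partialFst F) p = _root_.partialFst (_root_.partialSnd F) p := by
  have hd : DifferentiableAt ℝ (fderiv ℝ F) p :=
    (hF.fderiv_right (m := (⊤ : ℕ∞)) (by simp)).differentiableAt (by simp)
  have hsymm : IsSymmSndFDerivAt ℝ F p :=
    hF.isSymmSndFDerivAt (by simpa using WithTop.coe_le_coe.2 (le_top : (2 : ℕ∞) ≤ ⊤))
  have key (v w : ℝ × ℝ) :
      fderiv ℝ (fun q => fderiv ℝ F q v) p w = fderiv ℝ (fderiv ℝ F) p w v := by
    rw [fderiv_clm_apply hd (differentiableAt_const v)]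
    simp
  exact (key _ _).trans ((hsymm _ _).trans (key _ _).symm)

theorem partialFst_eq_of_eq {F : ℝ × ℝ → ℝ} {f : ℝ → ℝ} {u t f' : ℝ}
    (hF : ContDiffAt ℝ (⊤ : ℕ∞) F (u, t)) (h : ∀ u', F (u', t) = f u')
    (hf : HasDerivAt f f' u) : partialFst F (u, t) = f' := by
  have h1 := hF.differentiableAt_of_top.hasDerivAt_partialFst
  rw [funext h] at h1
  exact h1.unique hf

theorem partialSnd_eq_of_eqOn {D : Set ℝ} {F : ℝ × ℝ → ℝ} {f : ℝ → ℝ} {u t f' : ℝ}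
    (hD : UniqueDiffWithinAt ℝ D t) (ht : t ∈ D)
    (hF : ContDiffAt ℝ (⊤ : ℕ∞) F (u, t)) (h : ∀ t' ∈ D, F (u, t') = f t')
    (hf : HasDerivAt f f' t) : partialSnd F (u, t) = f' :=
  hD.eq_deriv _
    (hF.differentiableAt_of_top.hasDerivAt_partialSnd.hasDerivWithinAt (s := D))
    (hf.hasDerivWithinAt.congr h (h t ht))

theorem uniqueDiffWithinAt_timeDom {Tmax : EReal} {t : ℝ} (ht : t ∈ timeDom Tmax) :
    UniqueDiffWithinAt ℝ (timeDom Tmax) t := by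
  obtain ⟨s, hts, hs⟩ := EReal.lt_iff_exists_real_btwn.1 ht.2
  have hts' : t < s := EReal.coe_lt_coe_iff.1 hts
  refine (uniqueDiffOn_Icc hts' t ⟨le_rfl, hts'.le⟩).mono fun r hr => ⟨ht.1.trans hr.1, ?_⟩
  exact (EReal.coe_le_coe_iff.2 hr.2).trans_lt hs

/-- Evolution of the local length and of the curvature of a plane curve `(X, Y)` with unit
tangent `(c, d)` moving by `∂_t (X, Y) = β (-d, c) + α (c, d)`. -/
theorem evolution_length_curvature {D : Set ℝ} (hD : UniqueDiffOn ℝ D)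
    {X Y β α k g c d : ℝ × ℝ → ℝ}
    (hX : ContDiff ℝ (⊤ : ℕ∞) X) (hY : ContDiff ℝ (⊤ : ℕ∞) Y)
    (hβ : ContDiff ℝ (⊤ : ℕ∞) β) (hα : ContDiff ℝ (⊤ : ℕ∞) α) (hk : ContDiff ℝ (⊤ : ℕ∞) k)
    (hg : ∀ u, ∀ t ∈ D, ContDiffAt ℝ (⊤ : ℕ∞) g (u, t))
    (hc : ∀ u, ∀ t ∈ D, ContDiffAt ℝ (⊤ : ℕ∞) c (u, t))
    (hd : ∀ u, ∀ t ∈ D, ContDiffAt ℝ (⊤ : ℕ∞) d (u, t))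
    (hg0 : ∀ u, ∀ t ∈ D, g (u, t) ≠ 0)
    (hcd : ∀ u, ∀ t ∈ D, c (u, t) ^ 2 + d (u, t) ^ 2 = 1)
    (hXu : ∀ u, ∀ t ∈ D, partialFst X (u, t) = g (u, t) * c (u, t))
    (hYu : ∀ u, ∀ t ∈ D, partialFst Y (u, t) = g (u, t) * d (u, t))
    (hcu : ∀ u, ∀ t ∈ D, partialFst c (u, t) = -(g (u, t) * k (u, t) * d (u, t)))
    (hdu : ∀ u, ∀ t ∈ D, partialFst d (u, t) = g (u, t) * k (u, t) * c (u, t))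
    (hXt : ∀ u, ∀ t ∈ D, partialSnd X (u, t) = -(β (u, t) * d (u, t)) + α (u, t) * c (u, t))
    (hYt : ∀ u, ∀ t ∈ D, partialSnd Y (u, t) = β (u, t) * c (u, t) + α (u, t) * d (u, t))
    {u t : ℝ} (ht : t ∈ D) :
    partialSnd g (u, t) = partialFst α (u, t) - g (u, t) * k (u, t) * β (u, t) ∧
    g (u, t) * partialSnd k (u, t) =
      partialFst (fun p => (g p)⁻¹ * partialFst β p) (u, t)
        + α (u, t) * partialFst k (u, t) + g (u, t) * k (u, t) ^ 2 * β (u, t) := by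
  have first {F : ℝ × ℝ → ℝ} {u : ℝ} (hF : ContDiffAt ℝ (⊤ : ℕ∞) F (u, t)) :=
    hF.differentiableAt_of_top.hasDerivAt_partialFst
  have second {F : ℝ × ℝ → ℝ} {u : ℝ} (hF : ContDiffAt ℝ (⊤ : ℕ∞) F (u, t)) :=
    hF.differentiableAt_of_top.hasDerivAt_partialSnd
  have hDt := hD t ht
  have length_and_angle (u : ℝ) :
      partialSnd g (u, t) = partialFst α (u, t) - g (u, t) * k (u, t) * β (u, t) ∧
      partialSnd c (u, t) = -(((g (u, t))⁻¹ * partialFst β (u, t) + α (u, t) * k (u, t))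
        * d (u, t)) ∧
      partialSnd d (u, t) = ((g (u, t))⁻¹ * partialFst β (u, t) + α (u, t) * k (u, t))
        * c (u, t) := by
    have hgc := hg u t ht
    have hcc := hc u t ht
    have hdc := hd u t ht
    have e1 := hX.contDiffAt (x := (u, t)).partialSnd_partialFst
    have e2 := hY.contDiffAt (x := (u, t)).partialSnd_partialFst
    rw [partialSnd_eq_of_eqOn hDt ht hX.contDiffAt.partialFst (hXu u)
        ((second hgc).mul (second hcc)),
      partialFst_eq_of_eq hX.contDiffAt.partialSnd (fun u' => hXt u' t ht)
        (((first hβ.contDiffAt).mul (first hdc)).neg.add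
          ((first hα.contDiffAt).mul (first hcc))), hcu u t ht, hdu u t ht] at e1
    rw [partialSnd_eq_of_eqOn hDt ht hY.contDiffAt.partialFst (hYu u)
        ((second hgc).mul (second hdc)),
      partialFst_eq_of_eq hY.contDiffAt.partialSnd (fun u' => hYt u' t ht)
        (((first hβ.contDiffAt).mul (first hcc)).add
          ((first hα.contDiffAt).mul (first hdc))), hcu u t ht, hdu u t ht] at e2
    have e3 := partialSnd_eq_of_eqOn hDt ht ((hcc.pow 2).add (hdc.pow 2)) (f := fun _ => 1)
      (hcd u) (hasDerivAt_const t 1)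
    have e4 := partialSnd_eq_of_eqOn hDt ht ((hcc.pow 2).add (hdc.pow 2)) (fun _ _ => rfl)
      (((second hcc).pow 2).add ((second hdc).pow 2))
    rw [e3] at e4
    have e5 := hcd u t ht
    have h0 := hg0 u t ht
    generalize partialSnd c (u, t) = ct at *
    generalize partialSnd d (u, t) = dt at *
    generalize partialSnd g (u, t) = gt at *
    generalize partialFst β (u, t) = βu at *
    generalize partialFst α (u, t) = αu at *
    norm_num at e4
    generalize g (u, t) = g at *
    generalize c (u, t) = c at *
    generalize d (u, t) = d at *
    generalize k (u, t) = k at *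
    generalize β (u, t) = β at *
    generalize α (u, t) = α at *
    have hgt : gt = αu - g * k * β := by
      linear_combination c * e1 + d * e2 + g / 2 * e4 - (gt - αu + g * k * β) * e5
    refine ⟨hgt, ?_, ?_⟩
    · apply mul_left_cancel₀ h0
      field_simp
      linear_combination e1 - c * hgt
    · apply mul_left_cancel₀ h0
      field_simp
      linear_combination e2 - d * hgt
  refine ⟨(length_and_angle u).1, ?_⟩
  have hgc := hg u t ht
  have hcc := hc u t ht
  have hdc := hd u t ht
  have hs : ContDiffAt ℝ (⊤ : ℕ∞) (fun p => (g p)⁻¹ * partialFst β p) (u, t) :=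
    (hgc.inv (hg0 u t ht)).mul hβ.contDiffAt.partialFst
  have hω := (first hs).add ((first hα.contDiffAt).mul (first hk.contDiffAt))
  have e1 := hcc.partialSnd_partialFst
  have e2 := hdc.partialSnd_partialFst
  rw [partialSnd_eq_of_eqOn hDt ht hcc.partialFst (hcu u)
      (((second hgc).mul (second hk.contDiffAt)).mul (second hdc)).neg,
    partialFst_eq_of_eq hcc.partialSnd (fun u' => (length_and_angle u').2.1)
      (hω.mul (first hdc)).neg, hdu u t ht] at e1
  rw [partialSnd_eq_of_eqOn hDt ht hdc.partialFst (hdu u)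
      (((second hgc).mul (second hk.contDiffAt)).mul (second hcc)),
    partialFst_eq_of_eq hdc.partialSnd (fun u' => (length_and_angle u').2.2)
      (hω.mul (first hcc)), hcu u t ht] at e2
  obtain ⟨hgt, hct, hdt⟩ := length_and_angle u
  rw [hgt] at e1 e2
  rw [hdt] at e1
  rw [hct] at e2
  simp only [Pi.mul_apply, Pi.add_apply] at e1 e2
  have e5 := hcd u t ht
  set G := g (u, t)
  set C := c (u, t)
  set E := d (u, t)
  set K := k (u, t)
  set B := β (u, t)
  set A := α (u, t)
  set kt := partialSnd k (u, t)
  set ku := partialFst k (u, t)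
  set αu := partialFst α (u, t)
  set S := partialFst (fun p => (g p)⁻¹ * partialFst β p) (u, t)
  linear_combination C * e2 - E * e1 - (G * kt - S - A * ku - G * K ^ 2 * B) * e5

theorem deriv_fst_eq_partialFst {x : ℝ → ℝ → ℝ × ℝ} (hx : ContDiff ℝ (⊤ : ℕ∞) (Function.uncurry x))
    (u t : ℝ) :
    deriv (fun u' => x u' t) u =
      (partialFst (fun p => (Function.uncurry x p).1) (u, t),
        partialFst (fun p => (Function.uncurry x p).2) (u, t)) :=
  ((hx.fst.contDiffAt.differentiableAt_of_top.hasDerivAt_partialFst).prodMk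
    (hx.snd.contDiffAt.differentiableAt_of_top.hasDerivAt_partialFst)).deriv

theorem deriv_snd_eq_partialSnd {x : ℝ → ℝ → ℝ × ℝ}
    (hx : ContDiff ℝ (⊤ : ℕ∞) (Function.uncurry x)) (u t : ℝ) :
    deriv (fun t' => x u t') t =
      (partialSnd (fun p => (Function.uncurry x p).1) (u, t),
        partialSnd (fun p => (Function.uncurry x p).2) (u, t)) :=
  ((hx.fst.contDiffAt.differentiableAt_of_top.hasDerivAt_partialSnd).prodMk
    (hx.snd.contDiffAt.differentiableAt_of_top.hasDerivAt_partialSnd)).deriv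

/-- Under the motion law `∂_t x = β N + α T`, the quantity `ln(g φ(k))`
satisfies `∂_t ln(g φ(k)) = −f/φ(k) + ∂_s(φ(k)α)/φ(k)`, where
`f = φ(k) k β − (∂_s²β + k²β) φ'(k)` and `φ > 0` is smooth. -/
theorem log_g_phi_evolution
    (Tmax : EReal) (hTmax : 0 < Tmax)
    (x : ℝ → ℝ → ℝ × ℝ) (β α k : ℝ → ℝ → ℝ)
    (hx : ContDiff ℝ (⊤ : ℕ∞) (Function.uncurry x))
    (hβ : ContDiff ℝ (⊤ : ℕ∞) (Function.uncurry β))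
    (hα : ContDiff ℝ (⊤ : ℕ∞) (Function.uncurry α))
    (hk : ContDiff ℝ (⊤ : ℕ∞) (Function.uncurry k))
    (hxper : ∀ t : ℝ, Function.Periodic (fun u => x u t) 1)
    (hg : ∀ (u t : ℝ), t ∈ timeDom Tmax → 0 < gl x u t)
    (hfrenet : ∀ (u t : ℝ), t ∈ timeDom Tmax →
      deriv (fun u' => tang x u' t) u = (gl x u t * k u t) • nor x u t)
    (hmotion : ∀ (u t : ℝ), t ∈ timeDom Tmax →
      deriv (fun t' => x u t') t = β u t • nor x u t + α u t • tang x u t)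
    (φ : ℝ → ℝ) (hφ : ContDiff ℝ (⊤ : ℕ∞) φ) (hφpos : ∀ s : ℝ, 0 < φ s)
    :
    ∀ (u t : ℝ), t ∈ timeDom Tmax →
      deriv (fun t' => Real.log (gl x u t' * φ (k u t'))) t
        = -(fphi x φ k β u t / φ (k u t))
          + sder x (fun u' t' => φ (k u' t') * α u' t') u t / φ (k u t) := by
  set X : ℝ × ℝ → ℝ := fun p => (Function.uncurry x p).1 with hXdef
  set Y : ℝ × ℝ → ℝ := fun p => (Function.uncurry x p).2 with hYdef
  have hX : ContDiff ℝ (⊤ : ℕ∞) X := hx.fst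
  have hY : ContDiff ℝ (⊤ : ℕ∞) Y := hx.snd
  set g : ℝ × ℝ → ℝ := fun p => gl x p.1 p.2 with hgdef
  have hgl : g = fun p => √(partialFst X p ^ 2 + partialFst Y p ^ 2) := by
    funext p
    simp only [hgdef, gl, elen, deriv_fst_eq_partialFst hx, hXdef, hYdef]
  have hgpos (u t : ℝ) (ht : t ∈ timeDom Tmax) : 0 < g (u, t) := hg u t ht
  have hsq (u t : ℝ) (ht : t ∈ timeDom Tmax) :
      g (u, t) ^ 2 = partialFst X (u, t) ^ 2 + partialFst Y (u, t) ^ 2 := by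
    rw [hgl]
    exact Real.sq_sqrt (by positivity)
  have hgC (u t : ℝ) (ht : t ∈ timeDom Tmax) : ContDiffAt ℝ (⊤ : ℕ∞) g (u, t) := by
    have hne : partialFst X (u, t) ^ 2 + partialFst Y (u, t) ^ 2 ≠ 0 := by
      rw [← hsq u t ht]
      exact (pow_pos (hgpos u t ht) 2).ne'
    rw [hgl]
    exact ((hX.contDiffAt.partialFst.pow 2).add (hY.contDiffAt.partialFst.pow 2)).sqrt hne
  set c : ℝ × ℝ → ℝ := fun p => (g p)⁻¹ * partialFst X p with hcdef
  set d : ℝ × ℝ → ℝ := fun p => (g p)⁻¹ * partialFst Y p with hddef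
  have hcC (u t : ℝ) (ht : t ∈ timeDom Tmax) : ContDiffAt ℝ (⊤ : ℕ∞) c (u, t) :=
    ((hgC u t ht).inv (hgpos u t ht).ne').mul hX.contDiffAt.partialFst
  have hdC (u t : ℝ) (ht : t ∈ timeDom Tmax) : ContDiffAt ℝ (⊤ : ℕ∞) d (u, t) :=
    ((hgC u t ht).inv (hgpos u t ht).ne').mul hY.contDiffAt.partialFst
  have htang (u t : ℝ) : tang x u t = (c (u, t), d (u, t)) := by
    rw [tang, deriv_fst_eq_partialFst hx]
    rfl
  have hfr (u t : ℝ) (ht : t ∈ timeDom Tmax) :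
      partialFst c (u, t) = -(g (u, t) * k u t * d (u, t)) ∧
      partialFst d (u, t) = g (u, t) * k u t * c (u, t) := by
    have h := hfrenet u t ht
    simp only [nor, htang, rot] at h
    rw [((hcC u t ht).differentiableAt_of_top.hasDerivAt_partialFst.prodMk
      (hdC u t ht).differentiableAt_of_top.hasDerivAt_partialFst).deriv] at h
    simpa [Prod.ext_iff] using h
  have hmo (u t : ℝ) (ht : t ∈ timeDom Tmax) :
      partialSnd X (u, t) = -(β u t * d (u, t)) + α u t * c (u, t) ∧
      partialSnd Y (u, t) = β u t * c (u, t) + α u t * d (u, t) := by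
    have h := hmotion u t ht
    rw [deriv_snd_eq_partialSnd hx] at h
    simpa [nor, htang, rot, Prod.ext_iff] using h
  intro u t ht
  obtain ⟨hgt, hkt⟩ := evolution_length_curvature
    (fun _ => uniqueDiffWithinAt_timeDom) hX hY hβ hα hk hgC hcC hdC
    (fun u t ht => (hgpos u t ht).ne')
    (fun u t ht => by
      have := (hgpos u t ht).ne'
      simp only [hcdef, hddef, mul_pow, ← mul_add, ← hsq u t ht]
      field_simp)
    (fun u t ht => (mul_inv_cancel_left₀ (hgpos u t ht).ne' _).symm)
    (fun u t ht => (mul_inv_cancel_left₀ (hgpos u t ht).ne' _).symm)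
    (fun u t ht => (hfr u t ht).1) (fun u t ht => (hfr u t ht).2)
    (fun u t ht => (hmo u t ht).1) (fun u t ht => (hmo u t ht).2) (u := u) ht
  have h0 : gl x u t ≠ 0 := (hg u t ht).ne'
  have hφ0 : φ (k u t) ≠ 0 := (hφpos _).ne'
  have hφ' : HasDerivAt φ (deriv φ (k u t)) (k u t) :=
    (hφ.contDiffAt.differentiableAt (by simp)).hasDerivAt
  have hlog : HasDerivAt (fun t' => Real.log (gl x u t' * φ (k u t'))) _ t :=
    (((hgC u t ht).differentiableAt_of_top.hasDerivAt_partialSnd).mul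
      (hφ'.comp t hk.contDiffAt.differentiableAt_of_top.hasDerivAt_partialSnd)).log
      (mul_ne_zero h0 hφ0)
  have hsβ : sder x β = fun u t =>
      (g (u, t))⁻¹ * partialFst (Function.uncurry β) (u, t) := by
    funext u t
    exact congrArg _ hβ.contDiffAt.differentiableAt_of_top.hasDerivAt_partialFst.deriv
  have hssβ : sder x (sder x β) u t = (gl x u t)⁻¹ *
      partialFst (fun p => (g p)⁻¹ * partialFst (Function.uncurry β) p) (u, t) := by
    rw [hsβ]
    exact congrArg _ (((hgC u t ht).inv h0).mul
      hβ.contDiffAt.partialFst).differentiableAt_of_top.hasDerivAt_partialFst.deriv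
  have hsφα : sder x (fun u' t' => φ (k u' t') * α u' t') u t = (gl x u t)⁻¹ *
      (deriv φ (k u t) * partialFst (Function.uncurry k) (u, t) * α u t
        + φ (k u t) * partialFst (Function.uncurry α) (u, t)) :=
    congrArg _ ((hφ'.comp u
      hk.contDiffAt.differentiableAt_of_top.hasDerivAt_partialFst).mul
      hα.contDiffAt.differentiableAt_of_top.hasDerivAt_partialFst).deriv
  rw [hlog.deriv, hsφα, fphi, hssβ, hgt]
  simp only [hgdef, Function.uncurry_apply_pair, Function.comp_apply, Pi.mul_apply] at hkt ⊢
  generalize partialFst (fun p => (gl x p.1 p.2)⁻¹ * partialFst (Function.uncurry β) p) (u, t) = S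
    at hkt ⊢
  field_simp
  linear_combination deriv φ (k u t) * hkt
end
end

section
/- Suppose the tangential velocity α satisfies the curvature adjusted redistribution equation ∂_s(φ(k)α)/φ(k) = f/φ(k) − ⟨f⟩/⟨φ(k)⟩ + ω(t)(r_φ⁻¹ − 1), where f = φ(k) k β − (∂_s²β + k²β) φ'(k). Then θ := ln r_φ satisfies the ordinary differential equation ∂_t θ(u,t) = ω(t)(e^{−θ(u,t)} − 1) at every parameter value u. -/
noncomputable section

open Real Filter

section PartialDerivatives

open Topology Function
open scoped ContDiff

variable {E : Type*} [NormedAddCommGroup E] [NormedSpace ℝ E] {F : ℝ → ℝ → E} {u t : ℝ}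

theorem hasDerivAt_left_of_differentiableAt_uncurry
    (h : DifferentiableAt ℝ (uncurry F) (u, t)) :
    HasDerivAt (fun u' => F u' t) (fderiv ℝ (uncurry F) (u, t) (1, 0)) u := by
  have h1 : HasDerivAt (fun u' : ℝ => (u', t)) (1, 0) u :=
    (hasDerivAt_id u).prodMk (hasDerivAt_const u t)
  exact h.hasFDerivAt.comp_hasDerivAt u h1

theorem hasDerivAt_right_of_differentiableAt_uncurry
    (h : DifferentiableAt ℝ (uncurry F) (u, t)) :
    HasDerivAt (fun t' => F u t') (fderiv ℝ (uncurry F) (u, t) (0, 1)) t := by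
  have h1 : HasDerivAt (fun t' : ℝ => (u, t')) (0, 1) t :=
    (hasDerivAt_const t u).prodMk (hasDerivAt_id t)
  exact h.hasFDerivAt.comp_hasDerivAt t h1

theorem ContDiffAt.eventually_differentiableAt {V : Type*} [NormedAddCommGroup V]
    [NormedSpace ℝ V] {f : V → E} {p : V} (h : ContDiffAt ℝ ∞ f p) :
    ∀ᶠ q in 𝓝 p, DifferentiableAt ℝ f q :=
  ((h.of_le (m := 1) (mod_cast le_top)).eventually (by simp)).mono
    fun _ hq => hq.differentiableAt (by simp)

theorem deriv_left_eventuallyEq (h : ContDiffAt ℝ ∞ (uncurry F) (u, t)) :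
    uncurry (fun u t => deriv (fun u' => F u' t) u)
      =ᶠ[𝓝 (u, t)] fun p => fderiv ℝ (uncurry F) p (1, 0) :=
  h.eventually_differentiableAt.mono
    fun _ hp => (hasDerivAt_left_of_differentiableAt_uncurry hp).deriv

theorem deriv_right_eventuallyEq (h : ContDiffAt ℝ ∞ (uncurry F) (u, t)) :
    uncurry (fun u t => deriv (fun t' => F u t') t)
      =ᶠ[𝓝 (u, t)] fun p => fderiv ℝ (uncurry F) p (0, 1) :=
  h.eventually_differentiableAt.mono
    fun _ hp => (hasDerivAt_right_of_differentiableAt_uncurry hp).deriv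

theorem ContDiffAt.deriv_left (h : ContDiffAt ℝ ∞ (uncurry F) (u, t)) :
    ContDiffAt ℝ ∞ (uncurry fun u t => deriv (fun u' => F u' t) u) (u, t) :=
  ((h.fderiv_right (m := ∞) (by simp)).clm_apply contDiffAt_const).congr_of_eventuallyEq
    (deriv_left_eventuallyEq h)

theorem ContDiffAt.deriv_right (h : ContDiffAt ℝ ∞ (uncurry F) (u, t)) :
    ContDiffAt ℝ ∞ (uncurry fun u t => deriv (fun t' => F u t') t) (u, t) :=
  ((h.fderiv_right (m := ∞) (by simp)).clm_apply contDiffAt_const).congr_of_eventuallyEq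
    (deriv_right_eventuallyEq h)

theorem ContDiffAt.hasDerivAt_left (h : ContDiffAt ℝ ∞ (uncurry F) (u, t)) :
    HasDerivAt (fun u' => F u' t) (deriv (fun u' => F u' t) u) u :=
  (hasDerivAt_left_of_differentiableAt_uncurry
    (h.differentiableAt (by simp))).differentiableAt.hasDerivAt

theorem ContDiffAt.hasDerivAt_right (h : ContDiffAt ℝ ∞ (uncurry F) (u, t)) :
    HasDerivAt (fun t' => F u t') (deriv (fun t' => F u t') t) t :=
  (hasDerivAt_right_of_differentiableAt_uncurry
    (h.differentiableAt (by simp))).differentiableAt.hasDerivAt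

theorem ContDiffAt.deriv_right_deriv_left (h : ContDiffAt ℝ ∞ (uncurry F) (u, t)) :
    deriv (fun t' => deriv (fun u' => F u' t') u) t
      = deriv (fun u' => deriv (fun t' => F u' t') t) u := by
  have hd : DifferentiableAt ℝ (fderiv ℝ (uncurry F)) (u, t) :=
    (h.fderiv_right (m := ∞) (by simp)).differentiableAt (by simp)
  have hl := (hasDerivAt_right_of_differentiableAt_uncurry
    (F := fun u t => deriv (fun u' => F u' t) u)
    (h.deriv_left.differentiableAt (by simp))).deriv
  have hr := (hasDerivAt_left_of_differentiableAt_uncurry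
    (F := fun u t => deriv (fun t' => F u t') t)
    (h.deriv_right.differentiableAt (by simp))).deriv
  rw [hl, hr, (deriv_left_eventuallyEq h).fderiv_eq, (deriv_right_eventuallyEq h).fderiv_eq,
    fderiv_clm_apply hd (differentiableAt_const _), fderiv_clm_apply hd (differentiableAt_const _)]
  have hn : minSmoothness ℝ 2 ≤ ∞ := by
    rw [minSmoothness_of_isRCLikeNormedField]
    exact WithTop.coe_le_coe.2 le_top
  simpa using h.isSymmSndFDerivAt hn (0, 1) (1, 0)

theorem hasDerivAt_integral_of_contDiffAt {a b : ℝ} (hab : a ≤ b)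
    (h : ∀ u ∈ Set.Icc a b, ContDiffAt ℝ ∞ (uncurry F) (u, t)) :
    IntervalIntegrable (fun u => deriv (fun t' => F u t') t) MeasureTheory.volume a b ∧
      HasDerivAt (fun s => ∫ u in a..b, F u s)
        (∫ u in a..b, deriv (fun t' => F u t') t) t := by
  have hswap : ∀ u : ℝ, Tendsto (fun z : ℝ × ℝ => (z.2, z.1)) (𝓝 (t, u)) (𝓝 (u, t)) :=
    fun u => (continuous_swap.tendsto (t, u))
  have hcont : ∀ {G : ℝ → ℝ → E} {s : ℝ},
      (∀ u ∈ Set.Icc a b, ContinuousAt (uncurry G) (u, s)) →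
      ContinuousOn (fun u => G u s) (Set.Icc a b) := fun {G s} hG u hu =>
    (ContinuousAt.comp (f := fun u' : ℝ => (u', s)) (g := uncurry G) (hG u hu)
      (by fun_prop)).continuousWithinAt
  have hdiff : ∀ᶠ s in 𝓝 t, ∀ u ∈ Set.Icc a b, DifferentiableAt ℝ (uncurry F) (u, s) :=
    isCompact_Icc.eventually_forall_of_forall_eventually fun u hu =>
      (hswap u).eventually (h u hu).eventually_differentiableAt
  have hF' : ∀ u ∈ Set.Icc a b,
      ContinuousAt (uncurry fun u t => deriv (fun t' => F u t') t) (u, t) :=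
    fun u hu => (h u hu).deriv_right.continuousAt
  obtain ⟨M, hM⟩ := isCompact_Icc.exists_bound_of_continuousOn (hcont hF')
  have hbound : ∀ᶠ s in 𝓝 t, ∀ u ∈ Set.Icc a b, ‖deriv (fun t' => F u t') s‖ ≤ M + 1 :=
    isCompact_Icc.eventually_forall_of_forall_eventually fun u hu =>
      (hswap u).eventually (((hF' u hu).norm.eventually
        (gt_mem_nhds ((hM u hu).trans_lt (lt_add_one M)))).mono fun _ hz => le_of_lt hz)
  have hsub : Set.uIoc a b ⊆ Set.Icc a b := by
    rw [Set.uIoc_of_le hab]; exact Set.Ioc_subset_Icc_self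
  have hmeas : ∀ {f : ℝ → E}, ContinuousOn f (Set.Icc a b) →
      MeasureTheory.AEStronglyMeasurable f
        (MeasureTheory.volume.restrict (Set.uIoc a b)) := fun hf =>
    (hf.mono hsub).aestronglyMeasurable measurableSet_uIoc
  refine intervalIntegral.hasDerivAt_integral_of_dominated_loc_of_deriv_le
    (F := fun s u => F u s) (F' := fun s u => deriv (fun t' => F u t') s)
    (bound := fun _ => M + 1) (hdiff.and hbound) ?_ ?_ (hmeas (hcont hF')) ?_
    intervalIntegrable_const ?_
  · exact hdiff.mono fun s hs => hmeas (hcont fun u hu => (hs u hu).continuousAt)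
  · refine ContinuousOn.intervalIntegrable ?_
    rw [Set.uIcc_of_le hab]
    exact hcont fun u hu => (h u hu).continuousAt
  · exact .of_forall fun u hu s hs => hs.2 u (hsub hu)
  · exact .of_forall fun u hu s hs =>
      (hasDerivAt_right_of_differentiableAt_uncurry
        (hs.1 u (hsub hu))).differentiableAt.hasDerivAt

end PartialDerivatives

section CurveGeometry

open Topology Function
open scoped ContDiff

theorem HasDerivAt.eq_of_eventuallyEq_Ici {E : Type*} [NormedAddCommGroup E] [NormedSpace ℝ E]
    {f h : ℝ → E} {f' h' : E} {t : ℝ} (hf : HasDerivAt f f' t) (hh : HasDerivAt h h' t)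
    (heq : ∀ᶠ s in 𝓝[≥] t, f s = h s) : f' = h' :=
  (uniqueDiffWithinAt_Ici t).eq_deriv _ hf.hasDerivWithinAt
    (hh.hasDerivWithinAt.congr_of_eventuallyEq heq (heq.self_of_nhdsWithin Set.self_mem_Ici))

theorem eventually_mem_timeDom {Tmax : EReal} {t : ℝ} (ht : t ∈ timeDom Tmax) :
    ∀ᶠ s in 𝓝[≥] t, s ∈ timeDom Tmax := by
  have h1 : ∀ᶠ s : ℝ in 𝓝 t, (s : EReal) < Tmax :=
    (continuous_coe_real_ereal.tendsto t).eventually (gt_mem_nhds ht.2)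
  filter_upwards [h1.filter_mono nhdsWithin_le_nhds, self_mem_nhdsWithin] with s hs hts
  exact ⟨ht.1.trans hts, hs⟩

theorem HasDerivAt.fst_apply {f : ℝ → ℝ × ℝ} {f' : ℝ × ℝ} {t : ℝ} (hf : HasDerivAt f f' t) :
    HasDerivAt (fun s => (f s).1) f'.1 t :=
  HasFDerivAt.comp_hasDerivAt (l := Prod.fst) (l' := ContinuousLinearMap.fst ℝ ℝ ℝ) t
    hasFDerivAt_fst hf

theorem HasDerivAt.snd_apply {f : ℝ → ℝ × ℝ} {f' : ℝ × ℝ} {t : ℝ} (hf : HasDerivAt f f' t) :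
    HasDerivAt (fun s => (f s).2) f'.2 t :=
  HasFDerivAt.comp_hasDerivAt (l := Prod.snd) (l' := ContinuousLinearMap.snd ℝ ℝ ℝ) t
    hasFDerivAt_snd hf

theorem HasDerivAt.rot {f : ℝ → ℝ × ℝ} {f' : ℝ × ℝ} {t : ℝ} (hf : HasDerivAt f f' t) :
    HasDerivAt (fun s => _root_.rot (f s)) (_root_.rot f') t :=
  hf.snd_apply.neg.prodMk hf.fst_apply

theorem elen_sq (v : ℝ × ℝ) : elen v ^ 2 = v.1 ^ 2 + v.2 ^ 2 :=
  Real.sq_sqrt (by positivity)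

variable {x : ℝ → ℝ → ℝ × ℝ} {u t : ℝ}

theorem contDiffAt_gl (hx : ContDiff ℝ ∞ (uncurry x)) (hg : 0 < gl x u t) :
    ContDiffAt ℝ ∞ (uncurry (gl x)) (u, t) := by
  have hp := (hx.contDiffAt (x := (u, t))).deriv_left
  refine ContDiffAt.sqrt ((hp.fst.pow 2).add (hp.snd.pow 2)) ?_
  have := pow_pos hg 2
  rw [gl, elen_sq] at this
  exact this.ne'

theorem contDiffAt_tang (hx : ContDiff ℝ ∞ (uncurry x)) (hg : 0 < gl x u t) :
    ContDiffAt ℝ ∞ (uncurry (tang x)) (u, t) :=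
  ((contDiffAt_gl hx hg).inv hg.ne').smul (hx.contDiffAt (x := (u, t))).deriv_left

theorem gl_smul_tang (hg : 0 < gl x u t) :
    gl x u t • tang x u t = deriv (fun u' => x u' t) u :=
  smul_inv_smul₀ hg.ne' _

theorem tang_fst_sq_add_snd_sq (hg : 0 < gl x u t) :
    (tang x u t).1 ^ 2 + (tang x u t).2 ^ 2 = 1 := by
  have h := elen_sq (deriv (fun u' => x u' t) u)
  change gl x u t ^ 2 = _ at h
  rw [← gl_smul_tang hg] at h
  simp only [Prod.smul_fst, Prod.smul_snd, smul_eq_mul] at h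
  have hg2 := pow_pos hg 2
  refine mul_left_cancel₀ hg2.ne' ?_
  linarith

/-- Evolution of the tangent vector `∂_u x` under the motion law, in the frame `(T, N)`. -/
theorem hasDerivAt_deriv_left_of_motion {β α k : ℝ → ℝ → ℝ} {β' α' : ℝ}
    (hx : ContDiff ℝ ∞ (uncurry x)) (hg : 0 < gl x u t)
    (hfrenet : deriv (fun u' => tang x u' t) u = (gl x u t * k u t) • nor x u t)
    (hmotion : ∀ u, deriv (fun t' => x u t') t = β u t • nor x u t + α u t • tang x u t)
    (hβ : HasDerivAt (fun u' => β u' t) β' u) (hα : HasDerivAt (fun u' => α u' t) α' u) :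
    HasDerivAt (fun t' => deriv (fun u' => x u' t') u)
      ((β' + α u t * (gl x u t * k u t)) • nor x u t
        + (α' - β u t * (gl x u t * k u t)) • tang x u t) t := by
  have hT := (contDiffAt_tang hx hg).hasDerivAt_left
  have hxc : ContDiffAt ℝ ∞ (uncurry x) (u, t) := hx.contDiffAt
  have h := hxc.deriv_left.hasDerivAt_right
  have hvel : HasDerivAt (fun u' => β u' t • nor x u' t + α u' t • tang x u' t) _ u :=
    (hβ.smul hT.rot).add (hα.smul hT)
  rw [hxc.deriv_right_deriv_left, funext hmotion, hvel.deriv, hfrenet] at h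
  refine h.congr_deriv ?_
  ext <;> simp [nor, rot] <;> ring

theorem hasDerivAt_gl {β α k : ℝ → ℝ → ℝ} {β' α' : ℝ}
    (hx : ContDiff ℝ ∞ (uncurry x)) (hg : 0 < gl x u t)
    (hfrenet : deriv (fun u' => tang x u' t) u = (gl x u t * k u t) • nor x u t)
    (hmotion : ∀ u, deriv (fun t' => x u t') t = β u t • nor x u t + α u t • tang x u t)
    (hβ : HasDerivAt (fun u' => β u' t) β' u) (hα : HasDerivAt (fun u' => α u' t) α' u) :
    HasDerivAt (fun t' => gl x u t') (α' - β u t * (gl x u t * k u t)) t := by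
  have hp := hasDerivAt_deriv_left_of_motion hx hg hfrenet hmotion hβ hα
  have hT := tang_fst_sq_add_snd_sq hg
  have hg2 := pow_pos hg 2
  rw [gl, elen_sq] at hg2
  have h := ((hp.fst_apply.pow 2).add (hp.snd_apply.pow 2)).sqrt hg2.ne'
  refine h.congr_deriv ?_
  change _ / (2 * gl x u t) = _
  rw [div_eq_iff (by positivity), ← gl_smul_tang hg]
  simp [nor, rot]
  linear_combination (2 * gl x u t * (α' - β u t * (gl x u t * k u t))) * hT

theorem hasDerivAt_tang {β α k : ℝ → ℝ → ℝ} {β' α' : ℝ}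
    (hx : ContDiff ℝ ∞ (uncurry x)) (hg : 0 < gl x u t)
    (hfrenet : deriv (fun u' => tang x u' t) u = (gl x u t * k u t) • nor x u t)
    (hmotion : ∀ u, deriv (fun t' => x u t') t = β u t • nor x u t + α u t • tang x u t)
    (hβ : HasDerivAt (fun u' => β u' t) β' u) (hα : HasDerivAt (fun u' => α u' t) α' u) :
    HasDerivAt (fun t' => tang x u t')
      (((gl x u t)⁻¹ * β' + α u t * k u t) • nor x u t) t := by
  have hp := hasDerivAt_deriv_left_of_motion hx hg hfrenet hmotion hβ hα
  have h := ((hasDerivAt_gl hx hg hfrenet hmotion hβ hα).inv hg.ne').smul hp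
  refine h.congr_deriv ?_
  rw [← gl_smul_tang hg]
  ext <;> simp <;> field_simp <;> ring

/-- Evolution equation `∂_t k = ∂_s²β + k²β + α ∂_s k` of the curvature. -/
theorem hasDerivAt_curvature {Tmax : EReal} {β α k : ℝ → ℝ → ℝ}
    (hx : ContDiff ℝ ∞ (uncurry x)) (hβ : ContDiff ℝ ∞ (uncurry β))
    (hα : ContDiff ℝ ∞ (uncurry α)) (hk : ContDiff ℝ ∞ (uncurry k))
    (hg : ∀ u t : ℝ, t ∈ timeDom Tmax → 0 < gl x u t)
    (hfrenet : ∀ u t : ℝ, t ∈ timeDom Tmax →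
      deriv (fun u' => tang x u' t) u = (gl x u t * k u t) • nor x u t)
    (hmotion : ∀ u t : ℝ, t ∈ timeDom Tmax →
      deriv (fun t' => x u t') t = β u t • nor x u t + α u t • tang x u t)
    (ht : t ∈ timeDom Tmax) :
    HasDerivAt (fun t' => k u t')
      (sder x (sder x β) u t + (k u t) ^ 2 * β u t + α u t * sder x k u t) t := by
  have hgt := hg u t ht
  have hβu : ∀ u, HasDerivAt (fun u' => β u' t) _ u :=
    fun u => (hβ.contDiffAt (x := (u, t))).hasDerivAt_left
  have hαu : ∀ u, HasDerivAt (fun u' => α u' t) _ u :=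
    fun u => (hα.contDiffAt (x := (u, t))).hasDerivAt_left
  have hku := (hk.contDiffAt (x := (u, t))).hasDerivAt_left
  have hkt := (hk.contDiffAt (x := (u, t))).hasDerivAt_right
  have hTt : ∀ u, HasDerivAt (fun t' => tang x u t') _ t := fun u =>
    hasDerivAt_tang hx (hg u t ht) (hfrenet u t ht) (fun u => hmotion u t ht) (hβu u) (hαu u)
  have hgt' := hasDerivAt_gl hx hgt (hfrenet u t ht) (fun u => hmotion u t ht) (hβu u) (hαu u)
  have hTc := contDiffAt_tang hx hgt
  have hTu := hTc.hasDerivAt_left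
  rw [hfrenet u t ht] at hTu
  have hsβ : ContDiffAt ℝ ∞ (uncurry (sder x β)) (u, t) :=
    ((contDiffAt_gl hx hgt).inv hgt.ne').mul (hβ.contDiffAt (x := (u, t))).deriv_left
  have hleft := hTc.deriv_left.hasDerivAt_right
  have hrate : HasDerivAt (fun u' => ((gl x u' t)⁻¹ * deriv (fun u' => β u' t) u'
      + α u' t * k u' t) • nor x u' t) _ u :=
    (hsβ.hasDerivAt_left.add ((hαu u).mul hku)).smul hTu.rot
  rw [hTc.deriv_right_deriv_left, funext fun u => (hTt u).deriv, hrate.deriv] at hleft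
  have heq := hleft.eq_of_eventuallyEq_Ici ((hgt'.mul hkt).smul (hTt u).rot)
    ((eventually_mem_timeDom ht).mono fun s hs => hfrenet u s hs)
  have hT := tang_fst_sq_add_snd_sq hgt
  obtain ⟨h1, h2⟩ := Prod.ext_iff.1 heq
  simp [nor, rot] at h1 h2
  have hW : sder x β u t = (gl x u t)⁻¹ * deriv (fun u' => β u' t) u := rfl
  rw [hW] at h1 h2
  have hgk : (deriv (fun u' => α u' t) u - β u t * (gl x u t * k u t)) * k u t
      + gl x u t * deriv (fun t' => k u t') t
      = deriv (fun u' => sder x β u' t) u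
        + (deriv (fun u' => α u' t) u * k u t + α u t * deriv (fun u' => k u' t) u) := by
    linear_combination (tang x u t).2 * h1 - (tang x u t).1 * h2
      - ((deriv (fun u' => α u' t) u - β u t * (gl x u t * k u t)) * k u t
        + gl x u t * deriv (fun t' => k u t') t
        - deriv (fun u' => sder x β u' t) u
        - (deriv (fun u' => α u' t) u * k u t + α u t * deriv (fun u' => k u' t) u)) * hT
  refine hkt.congr_deriv (mul_left_cancel₀ hgt.ne' ?_)
  change _ = gl x u t * ((gl x u t)⁻¹ * deriv (fun u' => sder x β u' t) u
    + k u t ^ 2 * β u t + α u t * ((gl x u t)⁻¹ * deriv (fun u' => k u' t) u))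
  linear_combination hgk - (deriv (fun u' => sder x β u' t) u
    + α u t * deriv (fun u' => k u' t) u) * mul_inv_cancel₀ hgt.ne'

theorem Function.Periodic.deriv_of_periodic {E : Type*} [NormedAddCommGroup E] [NormedSpace ℝ E]
    {f : ℝ → E} {c : ℝ} (hf : Periodic f c) : Periodic (deriv f) c := fun u => by
  rw [← deriv_comp_add_const, funext hf]

theorem curvature_periodic {k : ℝ → ℝ → ℝ} (hper : Periodic (fun u => x u t) 1)
    (hg : ∀ u, 0 < gl x u t)
    (hfrenet : ∀ u, deriv (fun u' => tang x u' t) u = (gl x u t * k u t) • nor x u t) :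
    Periodic (fun u => k u t) 1 := fun u => by
  have hp : Periodic (fun u => deriv (fun u' => x u' t) u) 1 := hper.deriv_of_periodic
  have hgl : Periodic (fun u => gl x u t) 1 := fun v => congrArg elen (hp v)
  have hT : Periodic (fun u => tang x u t) 1 := fun v =>
    congrArg₂ (fun (a : ℝ) (w : ℝ × ℝ) => a⁻¹ • w) (hgl v) (hp v)
  have h := hT.deriv_of_periodic u
  have hN : nor x (u + 1) t = nor x u t := congrArg rot (hT u)
  have hgl' : gl x (u + 1) t = gl x u t := hgl u
  rw [hfrenet, hfrenet, hN, hgl'] at h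
  have hne : nor x u t ≠ 0 := fun h0 => by
    have h1 := tang_fst_sq_add_snd_sq (hg u)
    obtain ⟨h2, h3⟩ := Prod.ext_iff.1 h0
    simp only [nor, rot, Prod.fst_zero, Prod.snd_zero, neg_eq_zero] at h2 h3
    simp [h2, h3] at h1
  exact mul_left_cancel₀ (hg u).ne' (smul_left_injective ℝ hne h)

/-- Evolution of the weighted length density:
`∂_t (φ(k) g) = ∂_u (φ(k) α) - f g`. -/
theorem hasDerivAt_weighted_gl {Tmax : EReal} {β α k : ℝ → ℝ → ℝ} {φ : ℝ → ℝ}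
    (hx : ContDiff ℝ ∞ (uncurry x)) (hβ : ContDiff ℝ ∞ (uncurry β))
    (hα : ContDiff ℝ ∞ (uncurry α)) (hk : ContDiff ℝ ∞ (uncurry k)) (hφ : ContDiff ℝ ∞ φ)
    (hg : ∀ u t : ℝ, t ∈ timeDom Tmax → 0 < gl x u t)
    (hfrenet : ∀ u t : ℝ, t ∈ timeDom Tmax →
      deriv (fun u' => tang x u' t) u = (gl x u t * k u t) • nor x u t)
    (hmotion : ∀ u t : ℝ, t ∈ timeDom Tmax →
      deriv (fun t' => x u t') t = β u t • nor x u t + α u t • tang x u t)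
    (ht : t ∈ timeDom Tmax) :
    HasDerivAt (fun t' => φ (k u t') * gl x u t')
      (deriv (fun u' => φ (k u' t) * α u' t) u - fphi x φ k β u t * gl x u t) t := by
  have hgt := hg u t ht
  have hβu := (hβ.contDiffAt (x := (u, t))).hasDerivAt_left
  have hαu := (hα.contDiffAt (x := (u, t))).hasDerivAt_left
  have hku := (hk.contDiffAt (x := (u, t))).hasDerivAt_left
  have hφ' : HasDerivAt φ _ (k u t) := (hφ.differentiable (by simp) (k u t)).hasDerivAt
  have hgt' := hasDerivAt_gl hx hgt (hfrenet u t ht) (fun u => hmotion u t ht) hβu hαu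
  have hkt := hasDerivAt_curvature (u := u) hx hβ hα hk hg hfrenet hmotion ht
  have hφα : HasDerivAt (fun u' => φ (k u' t) * α u' t) _ u :=
    (hφ'.comp (h := fun u' => k u' t) u hku).mul hαu
  refine ((hφ'.comp (h := fun t' => k u t') t hkt).mul hgt').congr_deriv ?_
  have hsk : sder x k u t = (gl x u t)⁻¹ * deriv (fun u' => k u' t) u := rfl
  rw [hφα.deriv, fphi, hsk]
  simp only [Function.comp_apply]
  linear_combination (deriv φ (k u t) * α u t * deriv (fun u' => k u' t) u)
    * mul_inv_cancel₀ hgt.ne'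

end CurveGeometry

/-- If the tangential velocity `α` satisfies the curvature adjusted
redistribution equation
`∂_s(φ(k)α)/φ(k) = f/φ(k) − ⟨f⟩/⟨φ(k)⟩ + ω(t)(r_φ⁻¹ − 1)`, with
`f = φ(k) k β − (∂_s²β + k²β) φ'(k)`, then `θ := ln r_φ` satisfies the ODE
`∂_t θ(u,t) = ω(t)(e^{−θ(u,t)} − 1)` at every parameter value `u`. -/
theorem theta_ode_from_redistribution
    (Tmax : EReal) (hTmax : 0 < Tmax)
    (x : ℝ → ℝ → ℝ × ℝ) (β α k : ℝ → ℝ → ℝ)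
    (hx : ContDiff ℝ (⊤ : ℕ∞) (Function.uncurry x))
    (hβ : ContDiff ℝ (⊤ : ℕ∞) (Function.uncurry β))
    (hα : ContDiff ℝ (⊤ : ℕ∞) (Function.uncurry α))
    (hk : ContDiff ℝ (⊤ : ℕ∞) (Function.uncurry k))
    (hxper : ∀ t : ℝ, Function.Periodic (fun u => x u t) 1)
    (hg : ∀ (u t : ℝ), t ∈ timeDom Tmax → 0 < gl x u t)
    (hfrenet : ∀ (u t : ℝ), t ∈ timeDom Tmax →
      deriv (fun u' => tang x u' t) u = (gl x u t * k u t) • nor x u t)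
    (hmotion : ∀ (u t : ℝ), t ∈ timeDom Tmax →
      deriv (fun t' => x u t') t = β u t • nor x u t + α u t • tang x u t)
    (φ : ℝ → ℝ) (hφ : ContDiff ℝ (⊤ : ℕ∞) φ) (hφpos : ∀ s : ℝ, 0 < φ s)
    (hαper : ∀ t : ℝ, Function.Periodic (fun u => α u t) 1)
    (hβper : ∀ t : ℝ, Function.Periodic (fun u => β u t) 1)
    (ω : ℝ → ℝ) (hωcont : ContinuousOn ω (timeDom Tmax))
    (halpha : ∀ (u t : ℝ), t ∈ timeDom Tmax →
      sder x (fun u' t' => φ (k u' t') * α u' t') u t / φ (k u t)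
        = fphi x φ k β u t / φ (k u t)
          - avg x (fphi x φ k β) t / avg x (fun u' t' => φ (k u' t')) t
          + ω t * ((rphi x φ k u t)⁻¹ - 1)) :
    ∀ (u t : ℝ), t ∈ timeDom Tmax →
      deriv (fun t' => Real.log (rphi x φ k u t')) t
        = ω t * (Real.exp (-Real.log (rphi x φ k u t)) - 1) := by
  intro u t ht
  have hφk : ContDiff ℝ (⊤ : ℕ∞) (Function.uncurry fun u t => φ (k u t)) := hφ.comp hk
  have hGc : ∀ u, ContDiffAt ℝ (⊤ : ℕ∞)
      (Function.uncurry fun u t => φ (k u t) * gl x u t) (u, t) :=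
    fun u => hφk.contDiffAt.mul (contDiffAt_gl hx (hg u t ht))
  have hG : ∀ u, HasDerivAt (fun t' => φ (k u t') * gl x u t') _ t := fun u =>
    hasDerivAt_weighted_gl hx hβ hα hk hφ hg hfrenet hmotion ht
  have hφα : ContDiff ℝ (⊤ : ℕ∞) (fun u => φ (k u t) * α u t) :=
    (hφk.mul hα).comp (contDiff_id.prodMk contDiff_const : ContDiff ℝ _ fun u : ℝ => (u, t))
  have hφα_int : IntervalIntegrable (deriv fun u => φ (k u t) * α u t)
      MeasureTheory.volume 0 1 :=
    (hφα.continuous_deriv (by simp)).intervalIntegrable 0 1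
  obtain ⟨hGt_int, hH⟩ := hasDerivAt_integral_of_contDiffAt zero_le_one fun u _ => hGc u
  have hLcont : ContinuousAt (len x) t :=
    (hasDerivAt_integral_of_contDiffAt zero_le_one
      fun u _ => contDiffAt_gl hx (hg u t ht)).2.continuousAt
  have hslice : ∀ {F : ℝ → ℝ → ℝ},
      (∀ u, ContDiffAt ℝ (⊤ : ℕ∞) (Function.uncurry F) (u, t)) → Continuous fun u => F u t :=
    fun hF => continuous_iff_continuousAt.2 fun u => (hF u).hasDerivAt_left.continuousAt
  have hLpos : 0 < len x t :=
    intervalIntegral.intervalIntegral_pos_of_pos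
      ((hslice fun u => contDiffAt_gl hx (hg u t ht)).intervalIntegrable 0 1)
      (fun u => hg u t ht) one_pos
  have hHpos : 0 < ∫ u in (0:ℝ)..1, φ (k u t) * gl x u t :=
    intervalIntegral.intervalIntegral_pos_of_pos ((hslice hGc).intervalIntegrable 0 1)
      (fun u => mul_pos (hφpos _) (hg u t ht)) one_pos
  have hr : ∀ s, 0 < len x s →
      rphi x φ k u s = φ (k u s) * gl x u s / ∫ u in (0:ℝ)..1, φ (k u s) * gl x u s := by
    intro s hs
    rw [rphi, avg, mul_inv_cancel_left₀ hs.ne', mul_comm (gl x u s)]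
  have hGpos : 0 < φ (k u t) * gl x u t := mul_pos (hφpos _) (hg u t ht)
  have hrpos : 0 < rphi x φ k u t := by
    rw [hr t hLpos]
    exact div_pos hGpos hHpos
  have hkper := curvature_periodic (hxper t) (fun u => hg u t ht) fun u => hfrenet u t ht
  have hend : φ (k 1 t) * α 1 t = φ (k 0 t) * α 0 t := by
    have h1 : k (0 + 1) t = k 0 t := hkper 0
    have h2 : α (0 + 1) t = α 0 t := hαper t 0
    rw [zero_add] at h1 h2
    rw [h1, h2]
  have hfint : ∫ u in (0:ℝ)..1, deriv (fun t' => φ (k u t') * gl x u t') t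
      = -∫ u in (0:ℝ)..1, fphi x φ k β u t * gl x u t := by
    have hf : (fun u => fphi x φ k β u t * gl x u t) = fun u =>
        deriv (fun u => φ (k u t) * α u t) u - deriv (fun t' => φ (k u t') * gl x u t') t := by
      funext u
      rw [(hG u).deriv]
      ring
    rw [hf, intervalIntegral.integral_sub hφα_int hGt_int,
      intervalIntegral.integral_deriv_eq_sub
        (fun u _ => (hφα.differentiable (by simp)).differentiableAt) hφα_int, hend]
    ring
  have hlog : (fun t' => Real.log (rphi x φ k u t')) =ᶠ[nhds t] fun s =>
      Real.log (φ (k u s) * gl x u s / ∫ u in (0:ℝ)..1, φ (k u s) * gl x u s) :=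
    (hLcont.eventually (lt_mem_nhds hLpos)).mono fun s hs => congrArg Real.log (hr s hs)
  have hquot := ((hG u).div hH hHpos.ne').log (div_pos hGpos hHpos).ne'
  rw [hlog.deriv_eq]
  refine hquot.deriv.trans ?_
  rw [Real.exp_neg, Real.exp_log hrpos, hfint]
  have h := halpha u t ht
  have havg : avg x (fphi x φ k β) t / avg x (fun u' t' => φ (k u' t')) t
      = (∫ u in (0:ℝ)..1, fphi x φ k β u t * gl x u t)
        / ∫ u in (0:ℝ)..1, φ (k u t) * gl x u t :=
    mul_div_mul_left _ _ (inv_ne_zero hLpos.ne')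
  have hω : ω t * ((rphi x φ k u t)⁻¹ - 1)
      = sder x (fun u' t' => φ (k u' t') * α u' t') u t / φ (k u t)
        - fphi x φ k β u t / φ (k u t)
        + (∫ u in (0:ℝ)..1, fphi x φ k β u t * gl x u t)
          / ∫ u in (0:ℝ)..1, φ (k u t) * gl x u t := by
    rw [← havg]
    linarith
  have hgt := (hg u t ht).ne'
  have hφt := (hφpos (k u t)).ne'
  have hH0 := hHpos.ne'
  rw [hω, sder]
  simp only [Pi.div_apply]
  field_simp
  ring
end
end
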